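/- arXiv:1812.03774 — 2 statements merged into one kernel-verified Lean document; each statement's English description precedes it below -/
import Mathlib

section
/- Let H be a complex Hilbert space and θ ∈ [0, π/2). Let (a_n)_{n∈ℕ} be a sequence of closed sectorial forms in H with vertex 0 and angle θ such that dom(a_n) ⊇ dom(a_{n+1}) and the form a_{n+1} − a_n (with domain dom(a_{n+1})) is sectorial with vertex 0 and angle θ, for all n ∈ ℕ. Define dom(a) := {u ∈ ⋂_{n∈ℕ} dom(a_n) : sup_{n∈ℕ} Re a_n(u,u) < ∞}. Then dom(a) is a subspace of H, the limit a(u,v) := lim_{n→∞} a_n(u,v) exists for all u, v ∈ dom(a), and the form a thus defined is a closed sectorial form with vertex 0 and angle θ, i.e. (dom(a), ‖·‖_a) is complete. -/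
open Filter Topology ComplexConjugate

noncomputable section

variable {H : Type*} [NormedAddCommGroup H] [InnerProductSpace ℂ H] [CompleteSpace H]

/-- `a` is sesquilinear on `D`: linear in the first argument and conjugate-linear
in the second (the inner product being linear in the first argument). -/
def IsSesqOn (D : Set H) (a : H → H → ℂ) : Prop :=
  ∀ u ∈ D, ∀ v ∈ D, ∀ w ∈ D, ∀ c : ℂ,
    a (u + v) w = a u w + a v w ∧
    a (c • u) w = c * a u w ∧
    a u (v + w) = a u v + a u w ∧
    a u (c • v) = conj c * a u v

/-- `a` is sectorial on `D` with vertex `0` and angle `θ`. -/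
def IsSectorialOn (D : Set H) (a : H → H → ℂ) (θ : ℝ) : Prop :=
  ∀ u ∈ D, 0 ≤ (a u u).re ∧ |(a u u).im| ≤ Real.tan θ * (a u u).re

/-- The square `‖u‖_a² = Re a(u,u) + ‖u‖²` of the form norm. -/
def formNormSq (a : H → H → ℂ) (u : H) : ℝ := (a u u).re + ‖u‖ ^ 2

/-- The form `a` is closed on `D`: `(D, ‖·‖_a)` is complete, expressed via
Cauchy sequences for the form norm. -/
def IsClosedFormOn (D : Set H) (a : H → H → ℂ) : Prop :=
  ∀ u : ℕ → H, (∀ k, u k ∈ D) →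
    (∀ ε > 0, ∃ N : ℕ, ∀ m ≥ N, ∀ k ≥ N, formNormSq a (u m - u k) < ε) →
    ∃ x ∈ D, Tendsto (fun k => formNormSq a (u k - x)) atTop (nhds 0)

/-- The limit domain `dom(a) = {u ∈ ⋂ₙ dom(aₙ) : supₙ Re aₙ(u,u) < ∞}`. -/
def limDom (D : ℕ → Submodule ℂ H) (a : ℕ → H → H → ℂ) : Set H :=
  {u | (∀ n, u ∈ D n) ∧ ∃ M : ℝ, ∀ n, (a n u u).re ≤ M}

section

variable {E : Type*} [NormedAddCommGroup E] [InnerProductSpace ℂ E]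

/-- Expansion of the quadratic form along a line. -/
lemma IsSesqOn.apply_add_smul {S : Submodule ℂ E} {a : E → E → ℂ}
    (ha : IsSesqOn (S : Set E) a) {u v : E} (hu : u ∈ S) (hv : v ∈ S) (c : ℂ) :
    a (u + c • v) (u + c • v)
      = a u u + conj c * a u v + c * a v u + c * conj c * a v v := by
  have hcv : c • v ∈ S := S.smul_mem c hv
  have hadd := S.add_mem hu hcv
  rw [(ha u hu (c • v) hcv (u + c • v) hadd 0).1,
    (ha u hu u hu (c • v) hcv 0).2.2.1, (ha (c • v) hcv u hu (c • v) hcv 0).2.2.1,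
    (ha u hu v hv v hv c).2.2.2, (ha v hv v hv u hu c).2.1,
    (ha (c • v) hcv v hv v hv c).2.2.2, (ha v hv v hv v hv c).2.1]
  ring

lemma IsSesqOn.apply_smul_smul {S : Submodule ℂ E} {a : E → E → ℂ}
    (ha : IsSesqOn (S : Set E) a) {u : E} (hu : u ∈ S) (c : ℂ) :
    a (c • u) (c • u) = (Complex.normSq c : ℂ) * a u u := by
  rw [(ha _ (S.smul_mem c hu) u hu u hu c).2.2.2, (ha u hu u hu u hu c).2.1,
    Complex.normSq_eq_conj_mul_self]
  ring

lemma IsSesqOn.polarization {S : Submodule ℂ E} {a : E → E → ℂ}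
    (ha : IsSesqOn (S : Set E) a) {u v : E} (hu : u ∈ S) (hv : v ∈ S) :
    a u v = (a (u + (1 : ℂ) • v) (u + (1 : ℂ) • v)
      - a (u + (-1 : ℂ) • v) (u + (-1 : ℂ) • v)
      + Complex.I * a (u + Complex.I • v) (u + Complex.I • v)
      - Complex.I * a (u + (-Complex.I) • v) (u + (-Complex.I) • v)) / 4 := by
  simp only [ha.apply_add_smul hu hv, map_one, map_neg, Complex.conj_I]
  linear_combination (-(a u v) / 2 + a v u / 2) * (-Complex.I_sq)

lemma IsSesqOn.re_apply_add_le {S : Submodule ℂ E} {a : E → E → ℂ} {θ : ℝ}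
    (ha : IsSesqOn (S : Set E) a) (hs : IsSectorialOn (S : Set E) a θ)
    {u v : E} (hu : u ∈ S) (hv : v ∈ S) :
    (a (u + v) (u + v)).re ≤ 2 * (a u u).re + 2 * (a v v).re := by
  have hplus := congrArg Complex.re (ha.apply_add_smul hu hv 1)
  have hminus := congrArg Complex.re (ha.apply_add_smul hu hv (-1))
  have hnonneg := (hs _ (S.add_mem hu (S.smul_mem (-1) hv))).1
  simp only [one_smul, map_one, map_neg, Complex.add_re, one_mul, neg_mul, mul_neg, neg_neg,
    Complex.neg_re] at hplus hminus
  linarith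

/-- The elements of the limit domain form a submodule. -/
def limSubmodule (θ : ℝ) (D : ℕ → Submodule ℂ E) (a : ℕ → E → E → ℂ)
    (hsesq : ∀ n, IsSesqOn (D n : Set E) (a n))
    (hsect : ∀ n, IsSectorialOn (D n : Set E) (a n) θ) : Submodule ℂ E where
  carrier := limDom D a
  zero_mem' := ⟨fun n => (D n).zero_mem, 0, fun n => by
    have h := (hsesq n).apply_smul_smul (D n).zero_mem 0
    rw [smul_zero, map_zero, Complex.ofReal_zero, zero_mul] at h
    simp [h]⟩
  add_mem' := by
    rintro u v ⟨hu, M, hM⟩ ⟨hv, K, hK⟩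
    refine ⟨fun n => (D n).add_mem (hu n) (hv n), 2 * M + 2 * K, fun n => ?_⟩
    have := (hsesq n).re_apply_add_le (hsect n) (hu n) (hv n)
    linarith [hM n, hK n]
  smul_mem' := by
    rintro c u ⟨hu, M, hM⟩
    refine ⟨fun n => (D n).smul_mem c (hu n), Complex.normSq c * M, fun n => ?_⟩
    rw [(hsesq n).apply_smul_smul (hu n), Complex.re_ofReal_mul]
    exact mul_le_mul_of_nonneg_left (hM n) (Complex.normSq_nonneg c)

/-- The real parts of an increasing sequence of forms are monotone. -/
lemma monotone_re_of_sectorial_sub {θ : ℝ} {D : ℕ → Submodule ℂ E} {a : ℕ → E → E → ℂ}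
    (hdiff : ∀ n, IsSectorialOn (D (n + 1) : Set E)
      (fun u v => a (n + 1) u v - a n u v) θ) {u : E} (hu : ∀ n, u ∈ D n) :
    Monotone fun n => (a n u u).re :=
  monotone_nat_of_le_succ fun n => by
    have := (hdiff n u (hu (n + 1))).1
    rw [Complex.sub_re] at this
    linarith

/-- Convergence of the quadratic forms on the limit domain. -/
lemma exists_tendsto_apply_self {θ : ℝ} (hθ : θ ∈ Set.Ico 0 (Real.pi / 2))
    {D : ℕ → Submodule ℂ E} {a : ℕ → E → E → ℂ}
    (hsect : ∀ n, IsSectorialOn (D n : Set E) (a n) θ)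
    (hdiff : ∀ n, IsSectorialOn (D (n + 1) : Set E)
      (fun u v => a (n + 1) u v - a n u v) θ) {u : E} (hu : u ∈ limDom D a) :
    ∃ z : ℂ, Tendsto (fun n => a n u u) atTop (𝓝 z) := by
  obtain ⟨hu, M, hM⟩ := hu
  have htan : 0 ≤ Real.tan θ := Real.tan_nonneg_of_nonneg_of_le_pi_div_two hθ.1 hθ.2.le
  have hre := tendsto_atTop_ciSup (monotone_re_of_sectorial_sub hdiff hu)
    ⟨M, by rintro _ ⟨n, rfl⟩; exact hM n⟩
  have hmono : Monotone fun n => Real.tan θ * (a n u u).re + (a n u u).im :=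
    monotone_nat_of_le_succ fun n => by
      have := (abs_le.mp (hdiff n u (hu (n + 1))).2).1
      rw [Complex.sub_re, Complex.sub_im] at this
      linarith
  have hsum := tendsto_atTop_ciSup hmono ⟨2 * (Real.tan θ * M), by
    rintro _ ⟨n, rfl⟩
    have him := (abs_le.mp (hsect n u (hu n)).2).2
    have := mul_le_mul_of_nonneg_left (hM n) htan
    dsimp only
    linarith⟩
  have him := hsum.sub (hre.const_mul (Real.tan θ))
  simp only [add_sub_cancel_left] at him
  refine ⟨_, ((Complex.continuous_ofReal.tendsto _).comp hre).add
    (((Complex.continuous_ofReal.tendsto _).comp him).mul_const Complex.I) |>.congr fun n => ?_⟩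
  exact Complex.re_add_im _

/-- Convergence of the forms on the limit domain. -/
lemma exists_tendsto_apply {θ : ℝ} (hθ : θ ∈ Set.Ico 0 (Real.pi / 2))
    {D : ℕ → Submodule ℂ E} {a : ℕ → E → E → ℂ}
    (hsesq : ∀ n, IsSesqOn (D n : Set E) (a n))
    (hsect : ∀ n, IsSectorialOn (D n : Set E) (a n) θ)
    (hdiff : ∀ n, IsSectorialOn (D (n + 1) : Set E)
      (fun u v => a (n + 1) u v - a n u v) θ)
    {u v : E} (hu : u ∈ limDom D a) (hv : v ∈ limDom D a) :
    ∃ z : ℂ, Tendsto (fun n => a n u v) atTop (𝓝 z) := by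
  have hconv (c : ℂ) := exists_tendsto_apply_self hθ hsect hdiff
    ((limSubmodule θ D a hsesq hsect).add_mem hu
      ((limSubmodule θ D a hsesq hsect).smul_mem c hv))
  choose z hz using hconv
  exact ⟨_, ((((hz 1).sub (hz (-1))).add ((hz Complex.I).const_mul Complex.I)).sub
    ((hz (-Complex.I)).const_mul Complex.I)).div_const 4 |>.congr fun n =>
      ((hsesq n).polarization (hu.1 n) (hv.1 n)).symm⟩

lemma isSesqOn_of_tendsto {D : ℕ → Submodule ℂ E} {a : ℕ → E → E → ℂ} {S : Submodule ℂ E}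
    {b : E → E → ℂ} (hsesq : ∀ n, IsSesqOn (D n : Set E) (a n)) (hS : ∀ n, S ≤ D n)
    (hb : ∀ u ∈ S, ∀ v ∈ S, Tendsto (fun n => a n u v) atTop (𝓝 (b u v))) :
    IsSesqOn (S : Set E) b := by
  intro u hu v hv w hw c
  have h (n : ℕ) := hsesq n u (hS n hu) v (hS n hv) w (hS n hw) c
  refine ⟨tendsto_nhds_unique (hb _ (S.add_mem hu hv) w hw) ?_,
    tendsto_nhds_unique (hb _ (S.smul_mem c hu) w hw) ?_,
    tendsto_nhds_unique (hb u hu _ (S.add_mem hv hw)) ?_,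
    tendsto_nhds_unique (hb u hu _ (S.smul_mem c hv)) ?_⟩
  · exact ((hb u hu w hw).add (hb v hv w hw)).congr fun n => (h n).1.symm
  · exact ((hb u hu w hw).const_mul c).congr fun n => (h n).2.1.symm
  · exact ((hb u hu v hv).add (hb u hu w hw)).congr fun n => (h n).2.2.1.symm
  · exact ((hb u hu v hv).const_mul _).congr fun n => (h n).2.2.2.symm

lemma isSectorialOn_of_tendsto {D : ℕ → Submodule ℂ E} {a : ℕ → E → E → ℂ} {S : Submodule ℂ E}
    {b : E → E → ℂ} {θ : ℝ} (hsect : ∀ n, IsSectorialOn (D n : Set E) (a n) θ)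
    (hS : ∀ n, S ≤ D n)
    (hb : ∀ u ∈ S, ∀ v ∈ S, Tendsto (fun n => a n u v) atTop (𝓝 (b u v))) :
    IsSectorialOn (S : Set E) b θ := by
  intro u hu
  have hre := (Complex.continuous_re.tendsto _).comp (hb u hu u hu)
  have him := (Complex.continuous_im.tendsto _).comp (hb u hu u hu)
  exact ⟨ge_of_tendsto' hre fun n => (hsect n u (hS n hu)).1,
    le_of_tendsto_of_tendsto' him.abs (hre.const_mul _) fun n => (hsect n u (hS n hu)).2⟩

/-- Convergence in the form norm implies convergence of both of its summands. -/
lemma tendsto_of_formNormSq {S : Submodule ℂ E} {a : E → E → ℂ} {θ : ℝ}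
    (hs : IsSectorialOn (S : Set E) a θ) {u : ℕ → E} {x : E} (hu : ∀ k, u k ∈ S) (hx : x ∈ S)
    (h : Tendsto (fun k => formNormSq a (u k - x)) atTop (𝓝 0)) :
    Tendsto u atTop (𝓝 x) ∧
      Tendsto (fun k => (a (u k - x) (u k - x)).re) atTop (𝓝 0) := by
  have hnonneg (k : ℕ) := (hs _ (S.sub_mem (hu k) hx)).1
  refine ⟨?_, squeeze_zero hnonneg (fun k => le_add_of_nonneg_right (sq_nonneg _)) h⟩
  have hsq : Tendsto (fun k => ‖u k - x‖ ^ 2) atTop (𝓝 0) :=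
    squeeze_zero (fun k => sq_nonneg _) (fun k => le_add_of_nonneg_left (hnonneg k)) h
  rw [tendsto_iff_norm_sub_tendsto_zero]
  simpa [Real.sqrt_sq] using hsq.sqrt

/-- A Cauchy sequence for the limit form has a common limit for all approximating forms. -/
lemma exists_common_limit {θ : ℝ} {D : ℕ → Submodule ℂ E} {a : ℕ → E → E → ℂ}
    {S : Submodule ℂ E} {b : E → E → ℂ}
    (hsect : ∀ n, IsSectorialOn (D n : Set E) (a n) θ)
    (hclosed : ∀ n, IsClosedFormOn (D n : Set E) (a n)) (hS : ∀ n, S ≤ D n)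
    (hle : ∀ n, ∀ u ∈ S, (a n u u).re ≤ (b u u).re)
    {u : ℕ → E} (hu : ∀ k, u k ∈ S)
    (hcauchy : ∀ ε > 0, ∃ N : ℕ, ∀ m ≥ N, ∀ k ≥ N, formNormSq b (u m - u k) < ε) :
    ∃ x, Tendsto u atTop (𝓝 x) ∧ ∀ n, x ∈ D n ∧
      Tendsto (fun k => (a n (u k - x) (u k - x)).re) atTop (𝓝 0) := by
  have hlim (n : ℕ) : ∃ x, x ∈ D n ∧ Tendsto u atTop (𝓝 x) ∧
      Tendsto (fun k => (a n (u k - x) (u k - x)).re) atTop (𝓝 0) := by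
    obtain ⟨x, hx, hux⟩ := hclosed n u (fun k => hS n (hu k)) fun ε hε => by
      obtain ⟨N, hN⟩ := hcauchy ε hε
      exact ⟨N, fun m hm k hk => (add_le_add_left
        (hle n _ (S.sub_mem (hu m) (hu k))) _).trans_lt (hN m hm k hk)⟩
    exact ⟨x, hx, tendsto_of_formNormSq (hsect n) (fun k => hS n (hu k)) hx hux⟩
  choose x hxD hux hax using hlim
  refine ⟨x 0, hux 0, fun n => ?_⟩
  rw [tendsto_nhds_unique (hux 0) (hux n)]
  exact ⟨hxD n, hax n⟩

/-- A bound along a sequence passes, up to a factor, to its limit in the form norm. -/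
lemma re_apply_sub_le_of_tendsto {S : Submodule ℂ E} {a : E → E → ℂ} {θ : ℝ}
    (ha : IsSesqOn (S : Set E) a) (hs : IsSectorialOn (S : Set E) a θ)
    {u : ℕ → E} {x y : E} (hu : ∀ k, u k ∈ S) (hx : x ∈ S) (hy : y ∈ S)
    (hlim : Tendsto (fun k => (a (u k - x) (u k - x)).re) atTop (𝓝 0)) {C : ℝ}
    (hC : ∀ᶠ k in atTop, (a (y - u k) (y - u k)).re ≤ C) :
    (a (y - x) (y - x)).re ≤ 2 * C := by
  have hbound : Tendsto (fun k => 2 * C + 2 * (a (u k - x) (u k - x)).re) atTop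
      (𝓝 (2 * C)) := by
    simpa using (hlim.const_mul 2).const_add (2 * C)
  refine ge_of_tendsto hbound ?_
  filter_upwards [hC] with k hk
  have := ha.re_apply_add_le hs (S.sub_mem hy (hu k)) (S.sub_mem (hu k) hx)
  rw [sub_add_sub_cancel] at this
  linarith

/-- The limit form is closed. -/
lemma isClosedFormOn_limDom {θ : ℝ} {D : ℕ → Submodule ℂ E} {a : ℕ → E → E → ℂ}
    {b : E → E → ℂ} (hsesq : ∀ n, IsSesqOn (D n : Set E) (a n))
    (hsect : ∀ n, IsSectorialOn (D n : Set E) (a n) θ)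
    (hclosed : ∀ n, IsClosedFormOn (D n : Set E) (a n))
    (hdiff : ∀ n, IsSectorialOn (D (n + 1) : Set E)
      (fun u v => a (n + 1) u v - a n u v) θ)
    (hb : ∀ u ∈ limDom D a, ∀ v ∈ limDom D a,
      Tendsto (fun n => a n u v) atTop (𝓝 (b u v))) :
    IsClosedFormOn (limDom D a) b := by
  intro u hu hcauchy
  let S := limSubmodule θ D a hsesq hsect
  have hS (n : ℕ) : S ≤ D n := fun v hv => hv.1 n
  have hre (v : E) (hv : v ∈ S) : Tendsto (fun n => (a n v v).re) atTop (𝓝 (b v v).re) :=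
    (Complex.continuous_re.tendsto _).comp (hb v hv v hv)
  have hle (n : ℕ) (v : E) (hv : v ∈ S) : (a n v v).re ≤ (b v v).re :=
    (monotone_re_of_sectorial_sub hdiff hv.1).ge_of_tendsto (hre v hv) n
  have huS : ∀ k, u k ∈ S := hu
  obtain ⟨x, hux, hx⟩ := exists_common_limit hsect hclosed hS hle huS hcauchy
  have hbound (ε : ℝ) (hε : 0 < ε) : ∃ N : ℕ, ∀ m ≥ N, ∀ n,
      (a n (u m - x) (u m - x)).re ≤ 2 * ε := by
    obtain ⟨N, hN⟩ := hcauchy ε hε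
    refine ⟨N, fun m hm n => re_apply_sub_le_of_tendsto (hsesq n) (hsect n)
      (fun k => hS n (huS k)) (hx n).1 (hS n (huS m)) (hx n).2 ?_⟩
    filter_upwards [eventually_ge_atTop N] with k hk
    refine (hle n _ (S.sub_mem (huS m) (huS k))).trans (le_trans ?_ (hN m hm k hk).le)
    exact le_add_of_nonneg_right (sq_nonneg _)
  have hsub : ∃ m, u m - x ∈ S := by
    obtain ⟨N, hN⟩ := hbound 1 one_pos
    exact ⟨N, fun n => (D n).sub_mem (hS n (huS N)) (hx n).1, 2 * 1, hN N le_rfl⟩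
  have hxS : x ∈ S := by
    obtain ⟨m, hm⟩ := hsub
    simpa using S.sub_mem (huS m) hm
  refine ⟨x, hxS, ?_⟩
  have hform : Tendsto (fun k => (b (u k - x) (u k - x)).re) atTop (𝓝 0) := by
    rw [Metric.tendsto_atTop]
    intro ε hε
    obtain ⟨N, hN⟩ := hbound (ε / 4) (by positivity)
    refine ⟨N, fun m hm => ?_⟩
    have hmem := S.sub_mem (huS m) hxS
    have hnonneg := (hsect 0 _ (hS 0 hmem)).1.trans (hle 0 _ hmem)
    rw [Real.dist_eq, sub_zero, abs_of_nonneg hnonneg]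
    linarith [le_of_tendsto' (hre _ hmem) (hN m hm)]
  simpa [formNormSq] using hform.add ((tendsto_iff_norm_sub_tendsto_zero.mp hux).pow 2)

end

theorem statement1 (θ : ℝ) (hθ : θ ∈ Set.Ico 0 (Real.pi / 2))
    (D : ℕ → Submodule ℂ H) (a : ℕ → H → H → ℂ)
    (hsesq : ∀ n, IsSesqOn (D n : Set H) (a n))
    (hsect : ∀ n, IsSectorialOn (D n : Set H) (a n) θ)
    (hclosed : ∀ n, IsClosedFormOn (D n : Set H) (a n))
    (hdom : ∀ n, (D (n + 1) : Set H) ⊆ (D n : Set H))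
    (hdiff : ∀ n, IsSectorialOn (D (n + 1) : Set H)
      (fun u v => a (n + 1) u v - a n u v) θ) :
    (0 : H) ∈ limDom D a ∧
    (∀ u ∈ limDom D a, ∀ v ∈ limDom D a, u + v ∈ limDom D a) ∧
    (∀ c : ℂ, ∀ u ∈ limDom D a, c • u ∈ limDom D a) ∧
    ∃ b : H → H → ℂ,
      (∀ u ∈ limDom D a, ∀ v ∈ limDom D a,
        Tendsto (fun n => a n u v) atTop (nhds (b u v))) ∧
      IsSesqOn (limDom D a) b ∧
      IsSectorialOn (limDom D a) b θ ∧
      IsClosedFormOn (limDom D a) b := by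
  let S := limSubmodule θ D a hsesq hsect
  have hS (n : ℕ) : S ≤ D n := fun v hv => hv.1 n
  have hb : ∀ u ∈ limDom D a, ∀ v ∈ limDom D a,
      Tendsto (fun n => a n u v) atTop (𝓝 (limUnder atTop fun n => a n u v)) :=
    fun u hu v hv => tendsto_nhds_limUnder (exists_tendsto_apply hθ hsesq hsect hdiff hu hv)
  exact ⟨S.zero_mem, fun u hu v hv => S.add_mem hu hv, fun c u hu => S.smul_mem c hu,
    fun u v => limUnder atTop fun n => a n u v, hb,
    isSesqOn_of_tendsto (S := S) hsesq hS hb,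
    isSectorialOn_of_tendsto (S := S) hsect hS hb,
    isClosedFormOn_limDom hsesq hsect hclosed hdiff hb⟩
end
end

section
/- Let H be a complex Hilbert space, D ⊆ H a subspace, a : D × D → ℂ a sesquilinear form, and C > 0 such that Re a(u,u) ≥ 0 and |Im a(u,u)| ≤ C·Re a(u,u) for all u ∈ D. For z ∈ ℂ with |Re z| < 1/C define the sesquilinear form a_z := Re a + z·Im a, where Re a(u,v) := ½(a(u,v) + conj(a(v,u))) and Im a(u,v) := (1/(2i))(a(u,v) − conj(a(v,u))). Then for all u ∈ D: Re a_z(u,u) ≥ (1 − |Re z|·C)·Re a(u,u) ≥ 0 and |Im a_z(u,u)| ≤ (|Im z|·C)/(1 − |Re z|·C) · Re a_z(u,u); in particular a_z is a sectorial form with vertex 0. -/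
open ComplexConjugate

noncomputable section

variable {H : Type*} [NormedAddCommGroup H] [InnerProductSpace ℂ H] [CompleteSpace H]

/-- The real part `Re a` of the sesquilinear form `a`: `(Re a)(u,v) = ½(a(u,v) + conj a(v,u))`. -/
def formRe (a : H → H → ℂ) (u v : H) : ℂ := (a u v + conj (a v u)) / 2

/-- The imaginary part `Im a` of the sesquilinear form `a`:
`(Im a)(u,v) = (1/2i)(a(u,v) − conj a(v,u))`. -/
def formIm (a : H → H → ℂ) (u v : H) : ℂ := (a u v - conj (a v u)) / (2 * Complex.I)

theorem formRe_self {V : Type*} (a : V → V → ℂ) (u : V) : formRe a u u = ((a u u).re : ℂ) := by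
  rw [formRe, Complex.add_conj]
  push_cast
  ring

theorem formIm_self {V : Type*} (a : V → V → ℂ) (u : V) : formIm a u u = ((a u u).im : ℂ) := by
  rw [formIm, Complex.sub_conj, div_eq_iff (by simp)]
  push_cast
  ring

theorem statement5 (D : Submodule ℂ H) (a : H → H → ℂ)
    (hsesq : IsSesqOn (D : Set H) a)
    (C : ℝ) (hC : 0 < C)
    (hsec : ∀ u ∈ D, 0 ≤ (a u u).re ∧ |(a u u).im| ≤ C * (a u u).re)
    (z : ℂ) (hz : |z.re| < 1 / C) :
    ∀ u ∈ D,
      0 ≤ (1 - |z.re| * C) * (a u u).re ∧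
      (1 - |z.re| * C) * (a u u).re ≤ (formRe a u u + z * formIm a u u).re ∧
      |(formRe a u u + z * formIm a u u).im| ≤
        |z.im| * C / (1 - |z.re| * C) * (formRe a u u + z * formIm a u u).re := by
  intro u hu
  obtain ⟨hre, him⟩ := hsec u hu
  have hpos : 0 < 1 - |z.re| * C := by
    rw [lt_div_iff₀ hC] at hz
    linarith
  have hlower : (1 - |z.re| * C) * (a u u).re ≤ (a u u).re + z.re * (a u u).im := by
    have hmul : |z.re * (a u u).im| ≤ |z.re| * (C * (a u u).re) := by
      rw [abs_mul]
      gcongr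
    linarith [neg_le_of_abs_le hmul]
  simp only [formRe_self, formIm_self, Complex.add_re, Complex.add_im, Complex.re_mul_ofReal,
    Complex.im_mul_ofReal, Complex.ofReal_re, Complex.ofReal_im, zero_add]
  refine ⟨by positivity, hlower, ?_⟩
  calc |z.im * (a u u).im| = |z.im| * |(a u u).im| := abs_mul _ _
    _ ≤ |z.im| * (C * (a u u).re) := by gcongr
    _ = |z.im| * C / (1 - |z.re| * C) * ((1 - |z.re| * C) * (a u u).re) := by
      rw [← mul_assoc, ← mul_assoc, div_mul_cancel₀ _ hpos.ne']
    _ ≤ |z.im| * C / (1 - |z.re| * C) * ((a u u).re + z.re * (a u u).im) := by gcongr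
end
end
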